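/- arXiv:1702.04877 — 11 statements merged into one kernel-verified Lean document; each statement's English description precedes it below -/
import Mathlib

section
/- Let I, J ⊆ ℝ be open intervals, let ρ : I → ℝ and τ : J → ℝ be strictly monotone differentiable functions with nonvanishing derivatives, with inverse functions ρ⁻¹ : ρ(I) → I and τ⁻¹ : τ(J) → J, and let F : I → J be differentiable at p ∈ I. Then for any q ∈ I, the function α ↦ (1/(α(1-α)))·(τ⁻¹((1-α)·τ(F(p)) + α·τ(F(q))) − F(ρ⁻¹((1-α)·ρ(p) + α·ρ(q)))) tends, as α → 0⁺, to (τ(F(q)) − τ(F(p)))/τ′(F(p)) − ((ρ(q) − ρ(p))/ρ′(p))·F′(p). -/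
open Filter Topology Set

/-- A function that is continuous and strictly monotone on an open set of reals maps neighbourhoods
of a point of that set onto neighbourhoods of its image. -/
theorem nhds_le_map_of_strictMonoOn_or_strictAntiOn {s : Set ℝ} (hs : IsOpen s) {g : ℝ → ℝ}
    (hmono : StrictMonoOn g s ∨ StrictAntiOn g s) (hg : ContinuousOn g s) {a : ℝ} (ha : a ∈ s) :
    𝓝 (g a) ≤ map g (𝓝 a) := by
  intro t ht
  obtain ⟨ε, hε, hball⟩ := Metric.nhds_basis_closedBall.mem_iff.mp
    (inter_mem (mem_map.mp ht) (hs.mem_nhds ha))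
  rw [Real.closedBall_eq_Icc] at hball
  have hle : a - ε ≤ a + ε := by linarith
  have hl : a - ε ∈ s := (hball (left_mem_Icc.mpr hle)).2
  have hu : a + ε ∈ s := (hball (right_mem_Icc.mpr hle)).2
  have hcont : ContinuousOn g (Icc (a - ε) (a + ε)) := hg.mono fun x hx => (hball hx).2
  have himage : g '' Icc (a - ε) (a + ε) ⊆ t := image_subset_iff.mpr fun x hx => (hball hx).1
  rcases hmono with h | h
  · exact mem_of_superset
      (Icc_mem_nhds (h hl ha (by linarith)) (h ha hu (by linarith)))
      ((intermediate_value_Icc hle hcont).trans himage)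
  · exact mem_of_superset
      (Icc_mem_nhds (h ha hu (by linarith)) (h hl ha (by linarith)))
      ((intermediate_value_Icc' hle hcont).trans himage)

/-- The derivative of a left inverse of a strictly monotone function on an open set of reals. -/
theorem HasDerivAt.of_leftInvOn_of_strictMonoOn_or_strictAntiOn {s : Set ℝ} (hs : IsOpen s)
    {g ginv : ℝ → ℝ} (hmono : StrictMonoOn g s ∨ StrictAntiOn g s) (hg : ContinuousOn g s)
    (hinv : LeftInvOn ginv g s) {a g' : ℝ} (ha : a ∈ s) (hderiv : HasDerivAt g g' a)
    (hg' : g' ≠ 0) : HasDerivAt ginv g'⁻¹ (g a) := by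
  have hle := nhds_le_map_of_strictMonoOn_or_strictAntiOn hs hmono hg ha
  have hmem := hs.mem_nhds ha
  have hcont : ContinuousAt ginv (g a) := by
    have : Tendsto (ginv ∘ g) (𝓝 a) (𝓝 a) :=
      tendsto_id.congr' (by filter_upwards [hmem] with x hx using (hinv hx).symm)
    rw [ContinuousAt, hinv ha]
    exact (tendsto_map'_iff.mpr this).mono_left hle
  have hright : ∀ᶠ y in 𝓝 (g a), g (ginv y) = y := by
    refine hle (eventually_map.mpr ?_)
    filter_upwards [hmem] with x hx
    exact congrArg g (hinv hx)
  exact HasDerivAt.of_local_left_inverse hcont (by rwa [hinv ha]) hg' hright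

/-- The skew Jensen comparative convexity divergence for quasi-arithmetic
means `M_ρ`, `M_τ`, rescaled by `1/(α(1-α))`, tends as `α → 0⁺` to the
quasi-arithmetic Bregman divergence
`(τ(F q) − τ(F p))/τ′(F p) − ((ρ q − ρ p)/ρ′(p))·F′(p)`. -/
theorem quasiArithmetic_skewJensen_tendsto_bregman
    (I J : Set ℝ) (hI : IsOpen I) (hIc : I.OrdConnected)
    (hJ : IsOpen J) (hJc : J.OrdConnected)
    (ρ ρinv ρ' : ℝ → ℝ) (τ τinv τ' : ℝ → ℝ) (F F' : ℝ → ℝ)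
    (hρmono : StrictMonoOn ρ I ∨ StrictAntiOn ρ I)
    (hρdiff : ∀ x ∈ I, HasDerivAt ρ (ρ' x) x)
    (hρ'ne : ∀ x ∈ I, ρ' x ≠ 0)
    (hρinv : ∀ x ∈ I, ρinv (ρ x) = x)
    (hτmono : StrictMonoOn τ J ∨ StrictAntiOn τ J)
    (hτdiff : ∀ y ∈ J, HasDerivAt τ (τ' y) y)
    (hτ'ne : ∀ y ∈ J, τ' y ≠ 0)
    (hτinv : ∀ y ∈ J, τinv (τ y) = y)
    (hFmaps : Set.MapsTo F I J)
    (p : ℝ) (hp : p ∈ I) (hF : HasDerivAt F (F' p) p)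
    (q : ℝ) (hq : q ∈ I) :
    Tendsto (fun α : ℝ =>
        (1 / (α * (1 - α))) *
          (τinv ((1 - α) * τ (F p) + α * τ (F q))
            - F (ρinv ((1 - α) * ρ p + α * ρ q))))
      (𝓝[>] (0 : ℝ))
      (𝓝 ((τ (F q) - τ (F p)) / τ' (F p) - ((ρ q - ρ p) / ρ' p) * F' p)) := by
  have hτ : HasDerivAt τinv (τ' (F p))⁻¹ (τ (F p)) :=
    HasDerivAt.of_leftInvOn_of_strictMonoOn_or_strictAntiOn hJ hτmono
      (fun y hy => (hτdiff y hy).continuousAt.continuousWithinAt) hτinv (hFmaps hp)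
      (hτdiff _ (hFmaps hp)) (hτ'ne _ (hFmaps hp))
  have hρ : HasDerivAt ρinv (ρ' p)⁻¹ (ρ p) :=
    HasDerivAt.of_leftInvOn_of_strictMonoOn_or_strictAntiOn hI hρmono
      (fun x hx => (hρdiff x hx).continuousAt.continuousWithinAt) hρinv hp
      (hρdiff p hp) (hρ'ne p hp)
  have hseg (x y : ℝ) : HasDerivAt (fun α : ℝ => (1 - α) * x + α * y) (y - x) 0 := by
    have h := (((hasDerivAt_id (0 : ℝ)).const_sub 1).mul_const x).add
      ((hasDerivAt_id (0 : ℝ)).mul_const y)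
    exact h.congr_deriv (by ring)
  have hleft := HasDerivAt.comp_of_eq (0 : ℝ) hτ (hseg (τ (F p)) (τ (F q))) (by ring)
  have hmean := HasDerivAt.comp_of_eq (0 : ℝ) hρ (hseg (ρ p) (ρ q)) (by ring)
  have hright := HasDerivAt.comp_of_eq (0 : ℝ) hF hmean (by simp [hρinv p hp])
  have hslope := (hleft.sub hright).tendsto_slope_zero_right
  have hone : Tendsto (fun α : ℝ => (1 - α)⁻¹) (𝓝[>] 0) (𝓝 1) := by
    have h : ContinuousAt (fun α : ℝ => (1 - α)⁻¹) 0 :=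
      (continuousAt_const.sub continuousAt_id).inv₀ (by norm_num)
    simpa using h.tendsto.mono_left nhdsWithin_le_nhds
  convert hone.mul hslope using 2
  · simp [hρinv p hp, hτinv _ (hFmaps hp)]
    ring
  · ring
end

section
/- Let I ⊆ ℝ be an open interval, ρ : I → ℝ strictly monotone and differentiable with ρ′(q) ≠ 0 and inverse ρ⁻¹ satisfying ρ⁻¹(ρ(x)) = x on I, τ differentiable on an open interval containing F(I) with τ′(F(q)) ≠ 0, and F : I → ℝ differentiable at q ∈ I. Set G = τ ∘ F ∘ ρ⁻¹. Then for all p ∈ I, B^{ρ,τ}_F(p:q) = (1/τ′(F(q)))·(G(ρ(p)) − G(ρ(q)) − (ρ(p) − ρ(q))·G′(ρ(q))), i.e., the quasi-arithmetic Bregman divergence equals the ordinary Bregman divergence of G between ρ(p) and ρ(q), scaled by the conformal factor 1/τ′(F(q)). -/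
open Set

/-- A function that is continuous and strictly monotone on a neighbourhood of `x` maps
neighbourhoods of `x` to neighbourhoods of its value. -/
theorem nhds_le_map_nhds_of_strictMonoOn_or_strictAntiOn {f : ℝ → ℝ} {s : Set ℝ} {x : ℝ}
    (hs : s ∈ nhds x) (hf : ContinuousOn f s) (hmono : StrictMonoOn f s ∨ StrictAntiOn f s) :
    nhds (f x) ≤ Filter.map f (nhds x) := by
  intro t ht
  obtain ⟨ε, hε, hsub⟩ :=
    (nhds_basis_Icc_pos x).mem_iff.1 (Filter.inter_mem (Filter.mem_map.1 ht) hs)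
  have hsub_s : Icc (x - ε) (x + ε) ⊆ s := fun y hy => (hsub hy).2
  have hle : x - ε ≤ x + ε := by linarith
  have hl : x - ε ∈ s := hsub_s (left_mem_Icc.2 hle)
  have hr : x + ε ∈ s := hsub_s (right_mem_Icc.2 hle)
  have hx : x ∈ s := mem_of_mem_nhds hs
  have hcont := hf.mono hsub_s
  have himage : f '' Icc (x - ε) (x + ε) ⊆ t := image_subset_iff.2 fun y hy => (hsub hy).1
  rcases hmono with h | h
  · exact Filter.mem_of_superset
      (Icc_mem_nhds (h hl hx (by linarith)) (h hx hr (by linarith)))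
      ((intermediate_value_Icc hle hcont).trans himage)
  · exact Filter.mem_of_superset
      (Icc_mem_nhds (h hx hr (by linarith)) (h hl hx (by linarith)))
      ((intermediate_value_Icc' hle hcont).trans himage)

/-- The inverse function rule for a left inverse `g` of a strictly monotone function `f` that is
continuous on a neighbourhood of `x`. -/
theorem HasDerivAt.leftInverse_of_strictMonoOn_or_strictAntiOn {f g : ℝ → ℝ} {s : Set ℝ}
    {x f' : ℝ} (hs : s ∈ nhds x) (hcont : ContinuousOn f s)
    (hmono : StrictMonoOn f s ∨ StrictAntiOn f s) (hg : ∀ y ∈ s, g (f y) = y)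
    (hf : HasDerivAt f f' x) (hf' : f' ≠ 0) :
    HasDerivAt g f'⁻¹ (f x) := by
  have hmap := nhds_le_map_nhds_of_strictMonoOn_or_strictAntiOn hs hcont hmono
  have hgx : g (f x) = x := hg x (mem_of_mem_nhds hs)
  have hev : ∀ᶠ y in nhds x, g (f y) = y := Filter.eventually_of_mem hs hg
  have hgcont : ContinuousAt g (f x) := by
    have h : Filter.Tendsto g (Filter.map f (nhds x)) (nhds x) :=
      Filter.tendsto_map'_iff.2 (Filter.tendsto_id.congr' (hev.mono fun y hy => hy.symm))
    rw [ContinuousAt, hgx]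
    exact h.mono_left hmap
  have hright : ∀ᶠ z in nhds (f x), f (g z) = z :=
    hmap (Filter.eventually_map.2 (hev.mono fun y hy => congrArg f hy))
  exact HasDerivAt.of_local_left_inverse hgcont (by rwa [hgx]) hf' hright

/-- The quasi-arithmetic Bregman divergence
`B^{ρ,τ}_F(p:q) = (τ(F p) − τ(F q))/τ′(F q) − ((ρ p − ρ q)/ρ′(q))·F′(q)`
equals the ordinary Bregman divergence of `G = τ ∘ F ∘ ρ⁻¹` between `ρ(p)` and `ρ(q)`,
scaled by the conformal factor `1/τ′(F q)`. -/
theorem quasiArithmetic_bregman_eq_conformal_ordinary_bregman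
    (I J : Set ℝ) (hI : IsOpen I) (hIc : I.OrdConnected)
    (hJ : IsOpen J) (hJc : J.OrdConnected)
    (ρ ρinv ρ' : ℝ → ℝ) (τ τ' : ℝ → ℝ) (F F' : ℝ → ℝ)
    (hρmono : StrictMonoOn ρ I ∨ StrictAntiOn ρ I)
    (hρdiff : ∀ x ∈ I, HasDerivAt ρ (ρ' x) x)
    (hρinv : ∀ x ∈ I, ρinv (ρ x) = x)
    (hFmaps : Set.MapsTo F I J)
    (hτdiff : ∀ y ∈ J, HasDerivAt τ (τ' y) y)
    (q : ℝ) (hq : q ∈ I)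
    (hρ'q : ρ' q ≠ 0) (hτ'Fq : τ' (F q) ≠ 0)
    (hF : HasDerivAt F (F' q) q) :
    ∀ p ∈ I,
      (τ (F p) - τ (F q)) / τ' (F q) - ((ρ p - ρ q) / ρ' q) * F' q
        = (1 / τ' (F q)) *
            ((τ ∘ F ∘ ρinv) (ρ p) - (τ ∘ F ∘ ρinv) (ρ q)
              - (ρ p - ρ q) * deriv (τ ∘ F ∘ ρinv) (ρ q)) := by
  intro p hp
  have hinv : HasDerivAt ρinv (ρ' q)⁻¹ (ρ q) :=
    HasDerivAt.leftInverse_of_strictMonoOn_or_strictAntiOn (hI.mem_nhds hq)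
      (fun x hx => (hρdiff x hx).continuousAt.continuousWithinAt) hρmono hρinv (hρdiff q hq) hρ'q
  have hFinv : HasDerivAt (F ∘ ρinv) (F' q * (ρ' q)⁻¹) (ρ q) :=
    HasDerivAt.comp (ρ q) (by rwa [hρinv q hq]) hinv
  have hG : HasDerivAt (τ ∘ F ∘ ρinv) (τ' (F q) * (F' q * (ρ' q)⁻¹)) (ρ q) :=
    HasDerivAt.comp (ρ q)
      (by simpa only [Function.comp_apply, hρinv q hq] using hτdiff (F q) (hFmaps hq)) hFinv
  rw [hG.deriv]
  simp only [Function.comp_apply, hρinv p hp, hρinv q hq]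
  field_simp
end

section
/- Let I ⊆ ℝ be an open interval, ρ : I → ℝ strictly monotone and differentiable with nonvanishing derivative and inverse ρ⁻¹ on ρ(I), τ strictly increasing and differentiable with τ′ > 0 on an open interval containing F(I), and F : I → ℝ differentiable. If G = τ ∘ F ∘ ρ⁻¹ is strictly convex and differentiable on ρ(I), then for all p, q ∈ I the quasi-arithmetic Bregman divergence satisfies B^{ρ,τ}_F(p:q) ≥ 0, with B^{ρ,τ}_F(p:q) = 0 if and only if p = q; i.e., B^{ρ,τ}_F is a proper divergence. -/
open Set

/-- A strictly convex function lies strictly above its tangent line away from the contact point. -/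
theorem StrictConvexOn.tangent_lt_of_hasDerivWithinAt {S : Set ℝ} {f : ℝ → ℝ} {x y f' : ℝ}
    (hf : StrictConvexOn ℝ S f) (hx : x ∈ S) (hy : y ∈ S) (hxy : y ≠ x)
    (hf' : HasDerivWithinAt f f' S x) : f x + f' * (y - x) < f y := by
  rcases hxy.lt_or_gt with h | h
  · have hs := hf.slope_lt_of_hasDerivWithinAt hy hx h hf'
    rw [slope_def_field, div_lt_iff₀ (sub_pos.2 h)] at hs
    linarith
  · have hs := hf.lt_slope_of_hasDerivWithinAt hx hy h hf'
    rw [slope_def_field, lt_div_iff₀ (sub_pos.2 h)] at hs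
    linarith

/-- If `G = τ ∘ F ∘ ρ⁻¹` is strictly convex and differentiable on `ρ(I)`,
with `τ` strictly increasing (`τ′ > 0`), then the quasi-arithmetic Bregman divergence
`B^{ρ,τ}_F(p:q) = (τ(F p) − τ(F q))/τ′(F q) − ((ρ p − ρ q)/ρ′(q))·F′(q)` is a proper
divergence: nonnegative and vanishing iff `p = q`. -/
theorem quasiArithmetic_bregman_proper
    (I J : Set ℝ) (hI : IsOpen I) (hIc : I.OrdConnected)
    (hJ : IsOpen J) (hJc : J.OrdConnected)
    (ρ ρinv ρ' : ℝ → ℝ) (τ τ' : ℝ → ℝ) (F F' : ℝ → ℝ)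
    (hρmono : StrictMonoOn ρ I ∨ StrictAntiOn ρ I)
    (hρdiff : ∀ x ∈ I, HasDerivAt ρ (ρ' x) x)
    (hρ'ne : ∀ x ∈ I, ρ' x ≠ 0)
    (hρinv : ∀ x ∈ I, ρinv (ρ x) = x)
    (hFmaps : Set.MapsTo F I J)
    (hτmono : StrictMonoOn τ J)
    (hτdiff : ∀ y ∈ J, HasDerivAt τ (τ' y) y)
    (hτ'pos : ∀ y ∈ J, 0 < τ' y)
    (hFdiff : ∀ x ∈ I, HasDerivAt F (F' x) x)
    (hGconv : StrictConvexOn ℝ (ρ '' I) (τ ∘ F ∘ ρinv))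
    (hGdiff : DifferentiableOn ℝ (τ ∘ F ∘ ρinv) (ρ '' I)) :
    ∀ p ∈ I, ∀ q ∈ I,
      0 ≤ (τ (F p) - τ (F q)) / τ' (F q) - ((ρ p - ρ q) / ρ' q) * F' q
      ∧ ((τ (F p) - τ (F q)) / τ' (F q) - ((ρ p - ρ q) / ρ' q) * F' q = 0 ↔ p = q) := by
  intro p hp q hq
  have hτ'q : 0 < τ' (F q) := hτ'pos _ (hFmaps hq)
  obtain ⟨d, hd⟩ : ∃ d, HasDerivWithinAt (τ ∘ F ∘ ρinv) d (ρ '' I) (ρ q) :=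
    ⟨_, (hGdiff _ (mem_image_of_mem ρ hq)).hasDerivWithinAt⟩
  have hcomp : ∀ x ∈ I, (τ ∘ F ∘ ρinv) (ρ x) = τ (F x) := fun x hx => by
    simp only [Function.comp_apply, hρinv x hx]
  have hchain : d * ρ' q = τ' (F q) * F' q := by
    have h₁ : HasDerivWithinAt (τ ∘ F) (d * ρ' q) I q :=
      (hd.comp q (hρdiff q hq).hasDerivWithinAt (mapsTo_image ρ I)).congr
        (fun x hx => (hcomp x hx).symm) (hcomp q hq).symm
    exact (h₁.hasDerivAt (hI.mem_nhds hq)).unique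
      ((hτdiff _ (hFmaps hq)).comp q (hFdiff q hq))
  have hdiv : (τ (F p) - τ (F q)) / τ' (F q) - ((ρ p - ρ q) / ρ' q) * F' q
      = (τ (F p) - (τ (F q) + d * (ρ p - ρ q))) / τ' (F q) := by
    have hF' : F' q = d * ρ' q / τ' (F q) := by
      rw [hchain, mul_div_cancel_left₀ _ hτ'q.ne']
    have := hρ'ne q hq
    rw [hF']
    field_simp
    ring
  rcases eq_or_ne p q with rfl | hpq
  · simp
  · have hinj : InjOn ρ I := hρmono.elim StrictMonoOn.injOn StrictAntiOn.injOn
    have hlt := hGconv.tangent_lt_of_hasDerivWithinAt (mem_image_of_mem ρ hq)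
      (mem_image_of_mem ρ hp) (hinj.ne hp hq hpq) hd
    rw [hcomp q hq, hcomp p hp] at hlt
    have hpos := div_pos (sub_pos.2 hlt) hτ'q
    rw [hdiv]
    exact ⟨hpos.le, iff_of_false hpos.ne' hpq⟩
end

section
/- Let I ⊆ ℝ be an interval, F : I → ℝ differentiable at p ∈ I, and q ∈ I. Then (1/α)·((1-α)·F(p) + α·F(q) − F((1-α)·p + α·q)) tends, as α → 0⁺, to F(q) − F(p) − (q − p)·F′(p), the ordinary Bregman divergence B_F(q:p). -/
open Filter Topology Set

/-- The rescaled ordinary skew Jensen divergence tends, as `α → 0⁺`,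
to the ordinary Bregman divergence `B_F(q:p) = F(q) − F(p) − (q − p)·F′(p)`. -/
theorem skewJensen_tendsto_ordinary_bregman
    (I : Set ℝ) (hIc : I.OrdConnected)
    (F F' : ℝ → ℝ) (p q : ℝ) (hp : p ∈ I) (hq : q ∈ I)
    (hF : HasDerivWithinAt F (F' p) I p) :
    Tendsto (fun α : ℝ =>
        (1 / α) * ((1 - α) * F p + α * F q - F ((1 - α) * p + α * q)))
      (𝓝[>] (0 : ℝ))
      (𝓝 (F q - F p - (q - p) * F' p)) := by
  have hline : HasDerivWithinAt (fun α : ℝ => (1 - α) * p + α * q) (q - p) (Ioc 0 1) 0 := by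
    have h : HasDerivAt (fun α : ℝ => (1 - α) * p + α * q) (-1 * p + 1 * q) 0 :=
      (((hasDerivAt_id (0 : ℝ)).const_sub 1).mul_const p).add
        ((hasDerivAt_id (0 : ℝ)).mul_const q)
    exact (h.congr_deriv (by ring)).hasDerivWithinAt
  have hmaps : MapsTo (fun α : ℝ => (1 - α) * p + α * q) (Ioc 0 1) I := fun α hα =>
    hIc.convex hp hq (sub_nonneg.2 hα.2) hα.1.le (sub_add_cancel 1 α)
  have hF₀ : HasDerivWithinAt F (F' p) I ((1 - 0) * p + 0 * q) := by simpa using hF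
  have hslope := (hasDerivWithinAt_iff_tendsto_slope' (by simp)).1 (hF₀.comp 0 hline hmaps)
  rw [nhdsWithin_Ioc_eq_nhdsGT zero_lt_one] at hslope
  have hlim := hslope.const_sub (F q - F p)
  rw [mul_comm (F' p)] at hlim
  refine hlim.congr' ?_
  filter_upwards [self_mem_nhdsWithin] with α hα
  have hα₀ : α ≠ 0 := ne_of_gt hα
  simp only [slope_def_field, Function.comp_apply, sub_zero, one_mul, zero_mul, add_zero]
  field_simp
  ring
end

section
/- Let F : (0,∞) → (0,∞) be differentiable at p > 0, and let q > 0. Then (1/α)·(F(p)^{1-α}·F(q)^{α} − F(p^{1-α}·q^{α})) tends, as α → 0⁺, to F(p)·log(F(q)/F(p)) − p·log(q/p)·F′(p). This is the geometric ((G,G)-) Bregman divergence obtained from multiplicative convexity. -/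
open Filter Topology Set Real

/-- The weighted geometric mean of `a` and `b` has derivative `a * log (b / a)` in the weight
at weight `0`. -/
theorem hasDerivAt_weighted_geom_mean_zero {a b : ℝ} (ha : 0 < a) (hb : 0 < b) :
    HasDerivAt (fun α : ℝ => a ^ (1 - α) * b ^ α) (a * Real.log (b / a)) 0 := by
  have h₁ := ((hasDerivAt_id (0 : ℝ)).const_sub 1).const_rpow ha
  have h₂ := (hasDerivAt_id (0 : ℝ)).const_rpow hb
  refine (h₁.mul h₂).congr_deriv ?_
  rw [Real.log_div hb.ne' ha.ne']
  simp
  ring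

/-- The geometric `(G,G)`-Bregman divergence as a limit of skewed
geometric Jensen differences:
`(1/α)·(F(p)^{1-α} F(q)^α − F(p^{1-α} q^α)) → F(p)·log(F(q)/F(p)) − p·log(q/p)·F′(p)`
as `α → 0⁺`. -/
theorem geometric_bregman_limit
    (F F' : ℝ → ℝ) (hFpos : ∀ x, 0 < x → 0 < F x)
    (p q : ℝ) (hp : 0 < p) (hq : 0 < q)
    (hF : HasDerivAt F (F' p) p) :
    Tendsto (fun α : ℝ =>
        (1 / α) * (F p ^ (1 - α) * F q ^ α - F (p ^ (1 - α) * q ^ α)))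
      (𝓝[>] (0 : ℝ))
      (𝓝 (F p * Real.log (F q / F p) - p * Real.log (q / p) * F' p)) := by
  have h₁ := hasDerivAt_weighted_geom_mean_zero (hFpos p hp) (hFpos q hq)
  have h₂ : HasDerivAt (fun α : ℝ => F (p ^ (1 - α) * q ^ α))
      (F' p * (p * Real.log (q / p))) 0 :=
    HasDerivAt.comp (h₂ := F) 0 (by simpa using hF) (hasDerivAt_weighted_geom_mean_zero hp hq)
  have h := (h₁.sub h₂).tendsto_slope_zero_right
  rw [mul_comm (F' p)] at h
  simpa using h
end

section
/- Let I ⊆ ℝ be an interval, F : I → (0,∞) differentiable at p ∈ I, and q ∈ I. Then (1/α)·(F(p)^{1-α}·F(q)^{α} − F((1-α)·p + α·q)) tends, as α → 0⁺, to F(p)·log(F(q)/F(p)) − (q − p)·F′(p). This is the (A,G)-Bregman divergence obtained from log-convexity. -/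
open Filter Topology Set Real

/-- The `(A,G)`-Bregman divergence as a limit:
`(1/α)·(F(p)^{1-α} F(q)^α − F((1-α)p + αq)) → F(p)·log(F(q)/F(p)) − (q − p)·F′(p)`
as `α → 0⁺`. -/
theorem arithmetic_geometric_bregman_limit
    (I : Set ℝ) (hIc : I.OrdConnected)
    (F F' : ℝ → ℝ) (hFpos : ∀ x ∈ I, 0 < F x)
    (p q : ℝ) (hp : p ∈ I) (hq : q ∈ I)
    (hF : HasDerivWithinAt F (F' p) I p) :
    Tendsto (fun α : ℝ =>
        (1 / α) * (F p ^ (1 - α) * F q ^ α - F ((1 - α) * p + α * q)))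
      (𝓝[>] (0 : ℝ))
      (𝓝 (F p * Real.log (F q / F p) - (q - p) * F' p)) := by
  have hp0 := hFpos p hp
  have hq0 := hFpos q hq
  have hline : HasDerivWithinAt (fun α : ℝ => (1 - α) * p + α * q) (q - p) (Icc 0 1) 0 := by
    have h := (((hasDerivAt_id (0 : ℝ)).const_sub 1).mul_const p).add
      ((hasDerivAt_id (0 : ℝ)).mul_const q)
    exact (h.congr_deriv (by ring)).hasDerivWithinAt
  have hmaps : MapsTo (fun α : ℝ => (1 - α) * p + α * q) (Icc 0 1) I := fun α hα =>
    hIc.convex hp hq (sub_nonneg.2 hα.2) hα.1 (sub_add_cancel 1 α)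
  have hFline : HasDerivWithinAt (fun α : ℝ => F ((1 - α) * p + α * q)) (F' p * (q - p))
      (Icc 0 1) 0 :=
    HasDerivWithinAt.comp (h₂ := F) 0 (by simpa using hF) hline hmaps
  have hgeom : HasDerivWithinAt (fun α : ℝ => F p ^ (1 - α) * F q ^ α)
      (F p * Real.log (F q / F p)) (Icc 0 1) 0 := by
    have h := (((hasDerivAt_id (0 : ℝ)).const_sub 1).const_rpow hp0).mul
      ((hasDerivAt_id (0 : ℝ)).const_rpow hq0)
    refine (h.congr_deriv ?_).hasDerivWithinAt
    rw [Real.log_div hq0.ne' hp0.ne']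
    simp
    ring
  have hslope := (hasDerivWithinAt_iff_tendsto_slope' self_notMem_Ioi).1
    ((hgeom.sub hFline).mono_of_mem_nhdsWithin (Icc_mem_nhdsGT (zero_lt_one' ℝ)))
  rw [mul_comm (q - p)]
  refine hslope.congr fun α => ?_
  simp [slope_def_field, div_eq_inv_mul]
end

section
/- Let I ⊆ ℝ be an interval, F : I → (0,∞) differentiable at p ∈ I, and q ∈ I. Then (1/α)·( F(p)·F(q)/(α·F(p) + (1-α)·F(q)) − F((1-α)·p + α·q) ) tends, as α → 0⁺, to F(p)²·(1/F(p) − 1/F(q)) − (q − p)·F′(p). This is the (A,H)-Bregman divergence obtained from harmonic convexity of the codomain. -/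
open Filter Topology Set

/-- The `(A,H)`-Bregman divergence as a limit:
`(1/α)·(F(p)F(q)/(αF(p) + (1-α)F(q)) − F((1-α)p + αq))
  → F(p)²·(1/F(p) − 1/F(q)) − (q − p)·F′(p)` as `α → 0⁺`. -/
theorem arithmetic_harmonic_bregman_limit
    (I : Set ℝ) (hIc : I.OrdConnected)
    (F F' : ℝ → ℝ) (hFpos : ∀ x ∈ I, 0 < F x)
    (p q : ℝ) (hp : p ∈ I) (hq : q ∈ I)
    (hF : HasDerivWithinAt F (F' p) I p) :
    Tendsto (fun α : ℝ =>
        (1 / α) * (F p * F q / (α * F p + (1 - α) * F q) - F ((1 - α) * p + α * q)))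
      (𝓝[>] (0 : ℝ))
      (𝓝 (F p ^ 2 * (1 / F p - 1 / F q) - (q - p) * F' p)) := by
  have hFp : F p ≠ 0 := (hFpos p hp).ne'
  have hFq : F q ≠ 0 := (hFpos q hq).ne'
  have lineDeriv (a b : ℝ) :
      HasDerivWithinAt (fun α : ℝ => (1 - α) * a + α * b) (b - a) (Ioo 0 1) 0 := by
    have h := (((hasDerivAt_id (0 : ℝ)).const_sub 1).mul_const a).add
      ((hasDerivAt_id (0 : ℝ)).mul_const b)
    exact (h.congr_deriv (by ring)).hasDerivWithinAt
  have mapsTo : MapsTo (fun α : ℝ => (1 - α) * p + α * q) (Ioo 0 1) I := fun α hα =>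
    hIc.convex hp hq (sub_nonneg.2 hα.2.le) hα.1.le (sub_add_cancel 1 α)
  have arith : HasDerivWithinAt (fun α : ℝ => F ((1 - α) * p + α * q))
      (F' p * (q - p)) (Ioo 0 1) 0 :=
    HasDerivWithinAt.comp_of_eq 0 hF (lineDeriv p q) mapsTo (by simp)
  have harm : HasDerivWithinAt (fun α : ℝ => F p * F q / ((1 - α) * F q + α * F p))
      (F p ^ 2 * (1 / F p - 1 / F q)) (Ioo 0 1) 0 := by
    refine ((hasDerivWithinAt_const 0 _ (F p * F q)).div (lineDeriv (F q) (F p))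
      (by simpa using hFq)).congr_deriv ?_
    simp only [sub_zero, one_mul, zero_mul, add_zero]
    field_simp
    ring
  have slopeLimit := (hasDerivWithinAt_iff_tendsto_slope' (by simp)).1 (harm.sub arith)
  rw [nhdsWithin_Ioo_eq_nhdsGT one_pos, mul_comm (F' p)] at slopeLimit
  refine slopeLimit.congr fun α => ?_
  simp only [slope_def_field, Pi.sub_apply, sub_zero, one_mul, zero_mul, add_zero,
    mul_div_cancel_right₀ _ hFq, sub_self, add_comm (α * F p)]
  ring
end

section
/- Let δ₁, δ₂ ∈ ℝ \ {0}, let p, q > 0, and let F : (0,∞) → (0,∞) be differentiable at p. Then (1/α)·( ((1-α)·F(p)^{δ₂} + α·F(q)^{δ₂})^{1/δ₂} − F( ((1-α)·p^{δ₁} + α·q^{δ₁})^{1/δ₁} ) ) tends, as α → 0⁺, to (F(q)^{δ₂} − F(p)^{δ₂})/(δ₂·F(p)^{δ₂−1}) − ((q^{δ₁} − p^{δ₁})/(δ₁·p^{δ₁−1}))·F′(p). This is the power-mean Bregman divergence. -/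
open Filter Topology Set Real

/-- The weighted power mean of order `δ` has value `a` at weight `0`. -/
lemma weighted_power_mean_zero {δ a : ℝ} (b : ℝ) (hδ : δ ≠ 0) (ha : 0 < a) :
    ((1 - 0) * a ^ δ + 0 * b ^ δ) ^ (1 / δ) = a := by
  rw [sub_zero, one_mul, zero_mul, add_zero, one_div, rpow_rpow_inv ha.le hδ]

/-- The derivative at weight `0` of the weighted power mean of order `δ`. -/
lemma hasDerivAt_weighted_power_mean_zero {δ a : ℝ} (b : ℝ) (hδ : δ ≠ 0) (ha : 0 < a) :
    HasDerivAt (fun α : ℝ => ((1 - α) * a ^ δ + α * b ^ δ) ^ (1 / δ))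
      ((b ^ δ - a ^ δ) / (δ * a ^ (δ - 1))) 0 := by
  have hlin : HasDerivAt (fun α : ℝ => (1 - α) * a ^ δ + α * b ^ δ)
      (-1 * a ^ δ + 1 * b ^ δ) 0 :=
    (((hasDerivAt_id' (0 : ℝ)).const_sub 1).mul_const _).add
      ((hasDerivAt_id' (0 : ℝ)).mul_const _)
  have hpow : ((1 - 0) * a ^ δ + 0 * b ^ δ) ^ (1 / δ - 1) = (a ^ (δ - 1))⁻¹ := by
    rw [sub_zero, one_mul, zero_mul, add_zero, ← rpow_mul ha.le, ← rpow_neg ha.le]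
    congr 1
    field_simp
    ring
  have hne : (1 - 0) * a ^ δ + 0 * b ^ δ ≠ 0 := by
    simpa using (rpow_pos_of_pos ha δ).ne'
  convert hlin.rpow_const (p := 1 / δ) (Or.inl hne) using 1
  rw [hpow]
  have := (rpow_pos_of_pos ha (δ - 1)).ne'
  field_simp
  ring

/-- The power-mean `(P_{δ₁}, P_{δ₂})`-Bregman divergence as a limit:
`(1/α)·(P_{δ₂,α}(F(p),F(q)) − F(P_{δ₁,α}(p,q)))
  → (F(q)^{δ₂} − F(p)^{δ₂})/(δ₂ F(p)^{δ₂−1}) − ((q^{δ₁} − p^{δ₁})/(δ₁ p^{δ₁−1}))·F′(p)`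
as `α → 0⁺`. -/
theorem power_mean_bregman_limit
    (δ₁ δ₂ : ℝ) (hδ₁ : δ₁ ≠ 0) (hδ₂ : δ₂ ≠ 0)
    (F F' : ℝ → ℝ) (hFpos : ∀ x, 0 < x → 0 < F x)
    (p q : ℝ) (hp : 0 < p) (hq : 0 < q)
    (hF : HasDerivAt F (F' p) p) :
    Tendsto (fun α : ℝ =>
        (1 / α) * (((1 - α) * F p ^ δ₂ + α * F q ^ δ₂) ^ (1 / δ₂)
          - F (((1 - α) * p ^ δ₁ + α * q ^ δ₁) ^ (1 / δ₁))))
      (𝓝[>] (0 : ℝ))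
      (𝓝 ((F q ^ δ₂ - F p ^ δ₂) / (δ₂ * F p ^ (δ₂ - 1))
          - ((q ^ δ₁ - p ^ δ₁) / (δ₁ * p ^ (δ₁ - 1))) * F' p)) := by
  have hG := hasDerivAt_weighted_power_mean_zero (F q) hδ₂ (hFpos p hp)
  have hFG := HasDerivAt.comp (0 : ℝ)
    ((weighted_power_mean_zero q hδ₁ hp).symm ▸ hF :
      HasDerivAt F (F' p) (((1 - 0) * p ^ δ₁ + 0 * q ^ δ₁) ^ (1 / δ₁)))
    (hasDerivAt_weighted_power_mean_zero q hδ₁ hp)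
  have h := (hG.sub hFG).tendsto_slope_zero_right
  rw [mul_comm (F' p)] at h
  simpa only [Pi.sub_apply, Function.comp_apply, zero_add, smul_eq_mul, one_div,
    sub_zero, sub_self, one_mul, zero_mul, add_zero,
    rpow_rpow_inv hp.le hδ₁, rpow_rpow_inv (hFpos p hp).le hδ₂] using h
end

section
/- Let I ⊆ ℝ be an open interval, ρ : I → ℝ strictly monotone and differentiable with nonvanishing derivative and inverse ρ⁻¹ on ρ(I), and F : I → ℝ differentiable. Define B^{ρ}_F(p:q) = F(p) − F(q) − ((ρ(p) − ρ(q))/ρ′(q))·F′(q) and, for p, q ∈ I, let m = ρ⁻¹((ρ(p)+ρ(q))/2) ∈ I. Then (B^{ρ}_F(p:m) + B^{ρ}_F(q:m))/2 = (F(p)+F(q))/2 − F(m); that is, the (M_ρ, A)-Jensen–Bregman divergence equals the (M_ρ, A)-Jensen divergence. -/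
open Set

/-- With `τ = id`, the `(M_ρ, A)`-Jensen–Bregman divergence equals the
`(M_ρ, A)`-Jensen divergence: for `m = ρ⁻¹((ρ(p)+ρ(q))/2)`,
`(B^{ρ}_F(p:m) + B^{ρ}_F(q:m))/2 = (F(p)+F(q))/2 − F(m)`. -/
theorem jensen_bregman_eq_jensen
    (I : Set ℝ) (hI : IsOpen I) (hIc : I.OrdConnected)
    (ρ ρinv ρ' : ℝ → ℝ) (F F' : ℝ → ℝ)
    (hρmono : StrictMonoOn ρ I ∨ StrictAntiOn ρ I)
    (hρdiff : ∀ x ∈ I, HasDerivAt ρ (ρ' x) x)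
    (hρ'ne : ∀ x ∈ I, ρ' x ≠ 0)
    (hρinv : ∀ x ∈ I, ρinv (ρ x) = x)
    (hFdiff : ∀ x ∈ I, HasDerivAt F (F' x) x)
    (p q : ℝ) (hp : p ∈ I) (hq : q ∈ I)
    (m : ℝ) (hm : m = ρinv ((ρ p + ρ q) / 2)) (hmI : m ∈ I) :
    ((F p - F m - ((ρ p - ρ m) / ρ' m) * F' m)
      + (F q - F m - ((ρ q - ρ m) / ρ' m) * F' m)) / 2
    = (F p + F q) / 2 - F m := by
  have hImage : (ρ '' I).OrdConnected :=
    (hIc.isPreconnected.image ρ fun x hx =>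
      (hρdiff x hx).continuousAt.continuousWithinAt).ordConnected
  have hMid : (ρ p + ρ q) / 2 ∈ ρ '' I := by
    refine hImage.uIcc_subset (mem_image_of_mem ρ hp) (mem_image_of_mem ρ hq) ?_
    rw [mem_uIcc]
    rcases le_total (ρ p) (ρ q) with h | h
    · left; constructor <;> linarith
    · right; constructor <;> linarith
  obtain ⟨c, hc, hρc⟩ := hMid
  have hmc : m = c := by rw [hm, ← hρc, hρinv c hc]
  have hρm : ρ m = (ρ p + ρ q) / 2 := by rw [hmc, hρc]
  rw [hρm]
  ring
end

section
/- Let (X, ν) be a measure space, p, q : X → [0,∞) measurable, and let m, n : [0,∞) × [0,∞) → [0,∞) be continuous functions with m(a,b) ≤ n(a,b) for all a, b ≥ 0, and m(a,b) = n(a,b) if and only if a = b. Assume x ↦ m(p(x),q(x)) and x ↦ n(p(x),q(x)) are integrable with positive integrals. Then the comparative-mean Bhattacharyya distance Bhat^{m,n}(p:q) = −log( ∫ m(p(x),q(x)) dν(x) / ∫ n(p(x),q(x)) dν(x) ) satisfies Bhat^{m,n}(p:q) ≥ 0, with equality if and only if p = q ν-almost everywhere. -/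
open MeasureTheory Set

/-- For comparable means `m ≤ n` (pointwise on `[0,∞)²`, with equality
exactly on the diagonal), the comparative-mean Bhattacharyya distance
`−log(∫ m(p,q) dν / ∫ n(p,q) dν)` is nonnegative, and vanishes iff `p = q` ν-a.e. -/
theorem comparative_mean_bhattacharyya_proper
    (X : Type*) [MeasurableSpace X] (ν : Measure X)
    (p q : X → ℝ) (hpm : Measurable p) (hqm : Measurable q)
    (hpnn : ∀ x, 0 ≤ p x) (hqnn : ∀ x, 0 ≤ q x)
    (m n : ℝ → ℝ → ℝ)
    (hmcont : ContinuousOn (fun ab : ℝ × ℝ => m ab.1 ab.2) (Set.Ici 0 ×ˢ Set.Ici 0))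
    (hncont : ContinuousOn (fun ab : ℝ × ℝ => n ab.1 ab.2) (Set.Ici 0 ×ˢ Set.Ici 0))
    (hmnn : ∀ a b : ℝ, 0 ≤ a → 0 ≤ b → 0 ≤ m a b)
    (hmn : ∀ a b : ℝ, 0 ≤ a → 0 ≤ b → m a b ≤ n a b)
    (heq : ∀ a b : ℝ, 0 ≤ a → 0 ≤ b → (m a b = n a b ↔ a = b))
    (hmint : Integrable (fun x => m (p x) (q x)) ν)
    (hnint : Integrable (fun x => n (p x) (q x)) ν)
    (hmpos : 0 < ∫ x, m (p x) (q x) ∂ν)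
    (hnpos : 0 < ∫ x, n (p x) (q x) ∂ν) :
    0 ≤ - Real.log ((∫ x, m (p x) (q x) ∂ν) / (∫ x, n (p x) (q x) ∂ν))
    ∧ (- Real.log ((∫ x, m (p x) (q x) ∂ν) / (∫ x, n (p x) (q x) ∂ν)) = 0
        ↔ p =ᵐ[ν] q) := by
  have hle : ∀ x, m (p x) (q x) ≤ n (p x) (q x) := fun x => hmn _ _ (hpnn x) (hqnn x)
  have hint_le : ∫ x, m (p x) (q x) ∂ν ≤ ∫ x, n (p x) (q x) ∂ν :=
    integral_mono hmint hnint hle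
  have hratio_pos : 0 < (∫ x, m (p x) (q x) ∂ν) / ∫ x, n (p x) (q x) ∂ν := div_pos hmpos hnpos
  refine ⟨neg_nonneg.mpr (Real.log_nonpos hratio_pos.le ((div_le_one hnpos).mpr hint_le)), ?_⟩
  have hlog : - Real.log ((∫ x, m (p x) (q x) ∂ν) / ∫ x, n (p x) (q x) ∂ν) = 0
      ↔ ∫ x, m (p x) (q x) ∂ν = ∫ x, n (p x) (q x) ∂ν := by
    rw [neg_eq_zero, ← div_eq_one_iff_eq hnpos.ne']
    exact ⟨Real.eq_one_of_pos_of_log_eq_zero hratio_pos, fun h => by rw [h, Real.log_one]⟩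
  rw [hlog, integral_eq_iff_of_ae_le hmint hnint (Filter.Eventually.of_forall hle)]
  exact Filter.eventually_congr
    (Filter.Eventually.of_forall fun x => heq _ _ (hpnn x) (hqnn x))
end

section
/- Let K ⊆ ℝ be an open interval, g : K → ℝ differentiable and strictly convex, let I be a set, ρ : I → K an injection, let v₁, …, vₙ > 0 be positive weights with V = Σᵢ vᵢ, and a₁, …, aₙ ∈ K. If c ∈ I satisfies g′(ρ(c)) = (Σᵢ vᵢ·g′(aᵢ))/V, then c is the unique minimizer over I of the weighted Bregman loss m ↦ Σᵢ vᵢ·( g(ρ(m)) − g(aᵢ) − (ρ(m) − aᵢ)·g′(aᵢ) ); i.e., the generalized Bregman centroid is unique and given in closed form by g′(ρ(c)) = Σᵢ (vᵢ/V)·g′(aᵢ). -/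
open Set

/-- A strictly convex function lies strictly above its tangent lines, away from the point of
tangency. -/
theorem StrictConvexOn.tangent_lt_of_hasDerivAt {S : Set ℝ} {f : ℝ → ℝ} {f' x y : ℝ}
    (hf : StrictConvexOn ℝ S f) (hx : x ∈ S) (hy : y ∈ S) (hxy : y ≠ x)
    (hd : HasDerivAt f f' x) : f x + (y - x) * f' < f y := by
  rcases hxy.lt_or_gt with h | h
  · have hs := hf.slope_lt_of_hasDerivAt hy hx h hd
    rw [slope_def_field, div_lt_iff₀ (sub_pos.2 h)] at hs
    linarith
  · have hs := hf.lt_slope_of_hasDerivAt hx hy h hd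
    rw [slope_def_field, lt_div_iff₀ (sub_pos.2 h)] at hs
    linarith

/-- The difference of two values of a weighted Bregman loss. -/
theorem sum_bregman_sub_sum_bregman {ι : Type*} (s : Finset ι) (g g' : ℝ → ℝ) (v a : ι → ℝ)
    (x y : ℝ) :
    ∑ i ∈ s, v i * (g y - g (a i) - (y - a i) * g' (a i))
        - ∑ i ∈ s, v i * (g x - g (a i) - (x - a i) * g' (a i))
      = (∑ i ∈ s, v i) * (g y - g x) - (y - x) * ∑ i ∈ s, v i * g' (a i) := by
  rw [← Finset.sum_sub_distrib, Finset.sum_mul, Finset.mul_sum, ← Finset.sum_sub_distrib]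
  exact Finset.sum_congr rfl fun i _ => by ring

/-- Generalized Bregman centroid: if `g′(ρ(c)) = (Σᵢ vᵢ g′(aᵢ))/V`,
then `c` is the unique minimizer over `I` of the weighted Bregman loss
`m ↦ Σᵢ vᵢ (g(ρ(m)) − g(aᵢ) − (ρ(m) − aᵢ) g′(aᵢ))`. -/
theorem generalized_bregman_centroid_unique
    (K : Set ℝ) (hK : IsOpen K) (hKc : K.OrdConnected)
    (g g' : ℝ → ℝ)
    (hg : ∀ x ∈ K, HasDerivAt g (g' x) x)
    (hgconv : StrictConvexOn ℝ K g)
    (ι : Type*) (ρ : ι → ℝ) (hρK : ∀ i, ρ i ∈ K) (hρinj : Function.Injective ρ)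
    (nn : ℕ) (hnn : 1 ≤ nn)
    (v : Fin nn → ℝ) (hv : ∀ i, 0 < v i)
    (V : ℝ) (hV : V = ∑ i, v i)
    (a : Fin nn → ℝ) (ha : ∀ i, a i ∈ K)
    (c : ι) (hc : g' (ρ c) = (∑ i, v i * g' (a i)) / V) :
    (∀ m : ι,
        ∑ i, v i * (g (ρ c) - g (a i) - (ρ c - a i) * g' (a i))
          ≤ ∑ i, v i * (g (ρ m) - g (a i) - (ρ m - a i) * g' (a i)))
    ∧ ∀ m : ι,
        (∑ i, v i * (g (ρ m) - g (a i) - (ρ m - a i) * g' (a i))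
          = ∑ i, v i * (g (ρ c) - g (a i) - (ρ c - a i) * g' (a i))) → m = c := by
  have : NeZero nn := ⟨by omega⟩
  have hVpos : 0 < V := hV ▸ Finset.sum_pos (fun i _ => hv i) Finset.univ_nonempty
  rw [eq_div_iff hVpos.ne'] at hc
  have key : ∀ m, m ≠ c →
      ∑ i, v i * (g (ρ c) - g (a i) - (ρ c - a i) * g' (a i))
        < ∑ i, v i * (g (ρ m) - g (a i) - (ρ m - a i) * g' (a i)) := by
    intro m hm
    have ht := hgconv.tangent_lt_of_hasDerivAt (hρK c) (hρK m) (hρinj.ne hm) (hg _ (hρK c))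
    rw [← sub_pos, sum_bregman_sub_sum_bregman, ← hV, ← hc]
    linarith [mul_pos hVpos (sub_pos.2 ht)]
  refine ⟨fun m => ?_, fun m h => by_contra fun hm => (key m hm).ne' h⟩
  by_cases hm : m = c
  · rw [hm]
  · exact (key m hm).le
end
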